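/- Let F = ℂ(x, L) with x' = 1, L' = 1/x. If z ∈ ℂ(x)(L), β ∈ an algebraic closure of ℂ(x), and z' has a pole at β (as a rational function of L over the algebraic closure of ℂ(x)), then the pole order of z' at β is at least 2. Consequently, if r ∈ ℂ(x)(L) satisfies r' = c₁·(g'/g) + Σ_l c_l·(h_l'/h_l) for elements g, h_l ∈ ℂ(x)(L) and constants c₁, c_l (so r' is a sum of logarithmic derivatives, which has only simple poles), then r' ∈ ℂ(x) and r' has no poles at all in L. -/

import Mathlib

namespace Stmt15Aux

open Polynomial

variable {F : Type*} [Field F]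

/-- A derivation on `F(X)` with prescribed values on `F` and `X` restricts to polynomials. -/
lemma exists_restrict (δ : RatFunc F → RatFunc F)
    (hadd : ∀ a b, δ (a + b) = δ a + δ b) (hmul : ∀ a b, δ (a * b) = δ a * b + a * δ b)
    (d : F →+ F) (u : F) (hC : ∀ k, δ (RatFunc.C k) = RatFunc.C (d k))
    (hX : δ RatFunc.X = RatFunc.C u) (p : F[X]) :
    ∃ q : F[X], δ (algebraMap F[X] (RatFunc F) p) = algebraMap F[X] (RatFunc F) q ∧
      ∀ n, q.coeff n = d (p.coeff n) + u * (p.coeff (n + 1) * (n + 1)) := by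
  induction p using Polynomial.induction_on' with
  | add p q hp hq =>
    obtain ⟨p', hp1, hp2⟩ := hp
    obtain ⟨q', hq1, hq2⟩ := hq
    refine ⟨p' + q', by rw [map_add, hadd, hp1, hq1, map_add], fun n => ?_⟩
    rw [coeff_add, hp2, hq2, coeff_add, coeff_add, map_add]
    ring
  | monomial n a =>
    refine ⟨monomial n (d a) + C u * derivative (monomial n a), ?_, fun m => ?_⟩
    · have hone : δ 1 = 0 := by
        have := hmul 1 1
        simpa using this
      have hpow : ∀ n : ℕ, δ (RatFunc.X ^ n) =
          algebraMap F[X] (RatFunc F) (C u * derivative (X ^ n)) := by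
        intro n
        induction n with
        | zero => simpa using hone
        | succ n ih =>
          rw [pow_succ, hmul, ih, hX, pow_succ, derivative_mul]
          simp only [map_mul, map_add, RatFunc.algebraMap_C, RatFunc.algebraMap_X, map_pow,
            derivative_X, map_one]
          ring
      rw [← C_mul_X_pow_eq_monomial, map_mul, map_pow, RatFunc.algebraMap_C, RatFunc.algebraMap_X,
        hmul, hC, hpow, ← C_mul_X_pow_eq_monomial, derivative_mul, derivative_C]
      simp only [map_mul, map_add, RatFunc.algebraMap_C, RatFunc.algebraMap_X, map_pow, map_zero]
      ring
    · rw [coeff_add, coeff_C_mul, coeff_derivative, coeff_monomial, coeff_monomial,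
        coeff_monomial]
      split_ifs <;> simp

/-- Bundle of hypotheses: `δ` is a derivation of `F(X)` restricting to `D` on `F[X]`. -/
structure Restr (δ : RatFunc F → RatFunc F) (D : F[X] → F[X]) : Prop where
  add : ∀ a b, δ (a + b) = δ a + δ b
  mul : ∀ a b, δ (a * b) = δ a * b + a * δ b
  res : ∀ p, δ (algebraMap F[X] (RatFunc F) p) = algebraMap F[X] (RatFunc F) (D p)

variable {δ : RatFunc F → RatFunc F} {D : F[X] → F[X]}

lemma Restr.Dmul (H : Restr δ D) (p q : F[X]) : D (p * q) = D p * q + p * D q := by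
  apply RatFunc.algebraMap_injective F
  rw [← H.res, map_mul, H.mul, H.res, H.res]
  simp

lemma Restr.Dpow (H : Restr δ D) (p : F[X]) (n : ℕ) :
    D (p ^ (n + 1)) = ((n + 1 : ℕ) : F[X]) * p ^ n * D p := by
  induction n with
  | zero => simp
  | succ n ih =>
    rw [pow_succ, H.Dmul, ih]
    push_cast
    ring

lemma dvd_denom {z : RatFunc F} {w v : F[X]}
    (h : z * algebraMap F[X] (RatFunc F) w = algebraMap F[X] (RatFunc F) v) :
    z.num * w = v * z.denom := by
  apply RatFunc.algebraMap_injective F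
  have hd : algebraMap F[X] (RatFunc F) z.denom ≠ 0 := RatFunc.algebraMap_ne_zero z.denom_ne_zero
  have hz := RatFunc.num_div_denom z
  rw [div_eq_iff hd] at hz
  rw [map_mul, map_mul, hz, ← h]
  ring

lemma denom_dvd_of {z : RatFunc F} {w v : F[X]} (hw : w ≠ 0)
    (h : z * algebraMap F[X] (RatFunc F) w = algebraMap F[X] (RatFunc F) v) :
    z.denom ∣ w :=
  (RatFunc.denom_dvd hw).2 ⟨v, by
    rw [eq_div_iff (RatFunc.algebraMap_ne_zero hw), h]⟩

lemma exists_split {P q : F[X]} (hP : Irreducible P) (hq : q ≠ 0) :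
    ∃ (m : ℕ) (c : F[X]), q = P ^ m * c ∧ ¬ P ∣ c :=
  let ⟨c, h⟩ := (FiniteMultiplicity.of_prime_left hP.prime hq).exists_eq_pow_mul_and_not_dvd
  ⟨_, c, h⟩

lemma Restr.deriv_eq (H : Restr δ D) {z : RatFunc F} {w v : F[X]}
    (h : z * algebraMap F[X] (RatFunc F) w = algebraMap F[X] (RatFunc F) v) :
    δ z * algebraMap F[X] (RatFunc F) (w ^ 2) =
      algebraMap F[X] (RatFunc F) (D v * w - v * D w) := by
  have h2 := congrArg δ h
  rw [H.mul, H.res, H.res] at h2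
  rw [map_sub, map_mul, map_mul, map_pow, ← h2, ← h]
  ring

lemma Restr.not_dvd (H : Restr δ D) {P : F[X]} (hP : Irreducible P) (z : RatFunc F)
    (hz : ¬ P ∣ z.denom) : ¬ P ∣ (δ z).denom := by
  have hd := RatFunc.algebraMap_ne_zero z.denom_ne_zero
  have h := H.deriv_eq ((div_eq_iff hd).1 (RatFunc.num_div_denom z)).symm
  have := denom_dvd_of (pow_ne_zero 2 z.denom_ne_zero) h
  exact fun h' => hz (hP.prime.dvd_of_dvd_pow (h'.trans this))

lemma Restr.sq_dvd [CharZero F] (H : Restr δ D) {P : F[X]} (hP : Irreducible P) (hPD : ¬ P ∣ D P)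
    (z : RatFunc F) (hz : P ∣ z.denom) : P ^ 2 ∣ (δ z).denom := by
  have hd := RatFunc.algebraMap_ne_zero z.denom_ne_zero
  have h := H.deriv_eq ((div_eq_iff hd).1 (RatFunc.num_div_denom z)).symm
  obtain ⟨m, b, hb, hPb⟩ := exists_split hP z.denom_ne_zero
  have hnum : ¬ P ∣ z.num := fun h' =>
    hP.not_isUnit ((RatFunc.isCoprime_num_denom z).isUnit_of_dvd' h' hz)
  cases m with
  | zero => exact absurd hz (by simpa [hb] using hPb)
  | succ k =>
    have hP0 := hP.ne_zero
    have h1 := dvd_denom h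
    rw [hb, H.Dmul, H.Dpow] at h1
    set N := P * (D z.num * b - z.num * D b) - ((k + 1 : ℕ) : F[X]) * (z.num * b * D P) with hN
    have h2 : (δ z).num * b ^ 2 * P ^ (k + 2) = N * (δ z).denom := by
      apply mul_left_cancel₀ (pow_ne_zero k hP0)
      rw [hN]
      linear_combination h1
    have hNP : ¬ P ∣ N := by
      intro h'
      have h3 : P ∣ ((k + 1 : ℕ) : F[X]) * (z.num * b * D P) := by
        have := (Dvd.intro (D z.num * b - z.num * D b) rfl : P ∣ P * _).sub h'
        rwa [hN, sub_sub_cancel] at this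
      rcases hP.prime.dvd_or_dvd h3 with h3 | h3
      · have hu : IsUnit (((k + 1 : ℕ) : F[X])) := by
          rw [← map_natCast (C : F →+* F[X]), isUnit_C]
          exact (Nat.cast_ne_zero.2 (Nat.succ_ne_zero k)).isUnit
        exact hP.not_isUnit (isUnit_of_dvd_unit h3 hu)
      · rcases hP.prime.dvd_or_dvd h3 with h3 | h3
        · rcases hP.prime.dvd_or_dvd h3 with h3 | h3
          · exact hnum h3
          · exact hPb h3
        · exact hPD h3
    have h4 : P ^ (k + 2) ∣ (δ z).denom :=
      hP.prime.pow_dvd_of_dvd_mul_left _ hNP (h2 ▸ Dvd.intro_left _ rfl)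
    exact (pow_dvd_pow P (by omega)).trans h4

/-- no simple poles -/
lemma Restr.two [CharZero F] (H : Restr δ D) {P : F[X]} (hP : Irreducible P) (hPD : ¬ P ∣ D P)
    (z : RatFunc F) (hz : P ∣ (δ z).denom) : P ^ 2 ∣ (δ z).denom :=
  H.sq_dvd hP hPD z (by_contra fun h => H.not_dvd hP z h hz)

/-- At most a simple pole at `P`. -/
def SimpleAt (P : F[X]) (f : RatFunc F) : Prop :=
  ∃ e v : F[X], ¬ P ∣ e ∧ f * algebraMap F[X] (RatFunc F) (P * e) = algebraMap F[X] (RatFunc F) v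

lemma SimpleAt.add {P : F[X]} (hP : Irreducible P) {f g : RatFunc F} (hf : SimpleAt P f)
    (hg : SimpleAt P g) : SimpleAt P (f + g) := by
  obtain ⟨e, v, he, h⟩ := hf
  obtain ⟨e', v', he', h'⟩ := hg
  refine ⟨e * e', v * e' + v' * e, fun h => (hP.prime.dvd_or_dvd h).elim he he', ?_⟩
  rw [map_mul] at h h'
  simp only [map_mul, map_add]
  rw [← h, ← h']
  ring

lemma SimpleAt.smul {P : F[X]} {f : RatFunc F} (k : F) (hf : SimpleAt P f) :
    SimpleAt P (RatFunc.C k * f) := by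
  obtain ⟨e, v, he, h⟩ := hf
  refine ⟨e, C k * v, he, ?_⟩
  rw [mul_assoc, h, map_mul, RatFunc.algebraMap_C]

/-- Bounded at infinity. -/
def Bdd (f : RatFunc F) : Prop :=
  ∃ w v : F[X], w ≠ 0 ∧ v.degree ≤ w.degree ∧
    f * algebraMap F[X] (RatFunc F) w = algebraMap F[X] (RatFunc F) v

lemma Bdd.add {f g : RatFunc F} (hf : Bdd f) (hg : Bdd g) : Bdd (f + g) := by
  obtain ⟨e, v, he, hd, h⟩ := hf
  obtain ⟨e', v', he', hd', h'⟩ := hg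
  refine ⟨e * e', v * e' + v' * e, mul_ne_zero he he', ?_, ?_⟩
  · refine (degree_add_le _ _).trans (max_le ?_ ?_)
    · rw [degree_mul, degree_mul]; gcongr
    · rw [degree_mul, degree_mul, add_comm]; gcongr
  · simp only [map_mul, map_add]
    rw [← h, ← h']
    ring

lemma Bdd.smul {f : RatFunc F} (k : F) (hf : Bdd f) : Bdd (RatFunc.C k * f) := by
  obtain ⟨e, v, he, hd, h⟩ := hf
  refine ⟨e, C k * v, he, ?_, ?_⟩
  · by_cases hk : k = 0
    · simp [hk]
    · rwa [degree_C_mul hk]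
  · rw [mul_assoc, h, map_mul, RatFunc.algebraMap_C]

lemma Restr.logDeriv (H : Restr δ D) {g : RatFunc F} (hg : g ≠ 0) :
    δ g / g = algebraMap F[X] (RatFunc F) (D g.num) / algebraMap F[X] (RatFunc F) g.num
      + RatFunc.C (-1) *
        (algebraMap F[X] (RatFunc F) (D g.denom) / algebraMap F[X] (RatFunc F) g.denom) := by
  have hd := RatFunc.algebraMap_ne_zero g.denom_ne_zero
  have hn := RatFunc.algebraMap_ne_zero (RatFunc.num_ne_zero hg)
  have h0 := ((div_eq_iff hd).1 (RatFunc.num_div_denom g))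
  have h := congrArg δ h0
  rw [H.mul, H.res, H.res] at h
  rw [h, h0, map_neg, map_one]
  field_simp
  ring

lemma Restr.simple_poly (H : Restr δ D) {P : F[X]} (hP : Irreducible P) {p : F[X]} (hp : p ≠ 0) :
    SimpleAt P (algebraMap F[X] (RatFunc F) (D p) / algebraMap F[X] (RatFunc F) p) := by
  have hp' := RatFunc.algebraMap_ne_zero hp
  obtain ⟨m, b, hb, hPb⟩ := exists_split hP hp
  cases m with
  | zero =>
    refine ⟨b, P * D b, hPb, ?_⟩
    rw [pow_zero, one_mul] at hb
    subst hb
    rw [map_mul, map_mul]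
    field_simp
  | succ k =>
    refine ⟨b, ((k + 1 : ℕ) : F[X]) * D P * b + P * D b, hPb, ?_⟩
    rw [div_mul_eq_mul_div, div_eq_iff hp', ← map_mul, ← map_mul, hb, H.Dmul, H.Dpow]
    congr 1
    ring

lemma bdd_poly (hdeg : ∀ p, (D p).degree ≤ p.degree) {p : F[X]} (hp : p ≠ 0) :
    Bdd (algebraMap F[X] (RatFunc F) (D p) / algebraMap F[X] (RatFunc F) p) :=
  ⟨p, D p, hp, hdeg p, div_mul_cancel₀ _ (RatFunc.algebraMap_ne_zero hp)⟩

lemma denom_eq_one {z : RatFunc F} (h : ∀ P : F[X], P.Monic → Irreducible P → ¬ P ∣ z.denom) :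
    z.denom = 1 := by
  by_contra h1
  have hu : ¬ IsUnit z.denom := fun hu => h1 (z.monic_denom.eq_one_of_isUnit hu)
  obtain ⟨P, hm, hP, hd⟩ := exists_monic_irreducible_factor _ hu
  exact h P hm hP hd

lemma eq_num {z : RatFunc F} (h : z.denom = 1) : z = algebraMap F[X] (RatFunc F) z.num := by
  have := RatFunc.num_div_denom z
  rw [h, map_one, div_one] at this
  exact this.symm

lemma Restr.const [CharZero F] (H : Restr δ D)
    (hDP : ∀ P : F[X], P.Monic → Irreducible P → ¬ P ∣ D P) {c : RatFunc F} (hc : δ c = 0) :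
    ∃ k, c = RatFunc.C k := by
  by_cases h0 : c = 0
  · exact ⟨0, by simp [h0]⟩
  have key : ∀ c : RatFunc F, δ c = 0 → c.denom = 1 := fun c hc => denom_eq_one fun P hm hP hd => by
    have := H.sq_dvd hP (hDP P hm hP) c hd
    rw [hc, RatFunc.denom_zero] at this
    exact hP.not_isUnit (isUnit_of_dvd_one ((dvd_pow_self P two_ne_zero).trans this))
  have hone : δ 1 = 0 := by
    have := H.mul 1 1
    simpa using this
  have hi : δ c⁻¹ = 0 := by
    have := H.mul c c⁻¹
    rw [mul_inv_cancel₀ h0, hone, hc, zero_mul, zero_add] at this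
    exact (mul_eq_zero.1 this.symm).resolve_left h0
  have e1 := eq_num (key c hc)
  have e2 := eq_num (key _ hi)
  have hu : c.num * c⁻¹.num = 1 := by
    apply RatFunc.algebraMap_injective F
    rw [map_mul, ← e1, ← e2, mul_inv_cancel₀ h0, map_one]
  obtain ⟨k, -, hk⟩ := Polynomial.isUnit_iff.1 (IsUnit.of_mul_eq_one _ hu)
  exact ⟨k, by rw [e1, ← hk, RatFunc.algebraMap_C]⟩

lemma Restr.final [CharZero F] (H : Restr δ D)
    (hDP : ∀ P : F[X], P.Monic → Irreducible P → ¬ P ∣ D P) {r : RatFunc F}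
    (hs : ∀ P : F[X], Irreducible P → SimpleAt P (δ r)) (hb : Bdd (δ r)) :
    ∃ k, δ r = RatFunc.C k := by
  have h1 : (δ r).denom = 1 := denom_eq_one fun P hm hP hd => by
    have h2 := H.two hP (hDP P hm hP) r hd
    obtain ⟨e, v, he, h⟩ := hs P hP
    have he0 : e ≠ 0 := fun h => he (h ▸ dvd_zero P)
    have h3 := h2.trans (denom_dvd_of (mul_ne_zero hP.ne_zero he0) h)
    rw [pow_two] at h3
    exact he ((mul_dvd_mul_iff_left hP.ne_zero).1 h3)
  have h2 := eq_num h1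
  obtain ⟨w, v, hw, hd, h⟩ := hb
  rw [h2, ← map_mul] at h
  have h3 := RatFunc.algebraMap_injective F h
  rw [← h3, degree_mul] at hd
  have h4 : (δ r).num.degree ≤ 0 := by
    rw [degree_eq_natDegree hw] at hd
    by_cases h0 : (δ r).num = 0
    · simp [h0]
    · rw [degree_eq_natDegree h0] at hd ⊢
      norm_cast at hd ⊢
      omega
  rw [eq_C_of_degree_le_zero h4, RatFunc.algebraMap_C] at h2
  exact ⟨_, h2⟩

/-- `1/x` has no antiderivative in `F(x)`. -/
lemma no_antideriv [CharZero F] (δ : RatFunc F → RatFunc F)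
    (hadd : ∀ a b, δ (a + b) = δ a + δ b) (hmul : ∀ a b, δ (a * b) = δ a * b + a * δ b)
    (hC : ∀ k, δ (RatFunc.C k) = 0) (hX : δ RatFunc.X = 1) (f : RatFunc F) :
    δ f ≠ RatFunc.X⁻¹ := by
  intro hf
  choose D hD hDc using exists_restrict δ hadd hmul 0 1 (by simpa using hC) (by simpa using hX)
  have H : Restr δ D := ⟨hadd, hmul, hD⟩
  have hDX : D X = 1 := by
    apply RatFunc.algebraMap_injective F
    rw [← hD, RatFunc.algebraMap_X, hX, map_one]
  have h1 : (δ f) * algebraMap F[X] (RatFunc F) X = algebraMap F[X] (RatFunc F) 1 := by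
    rw [hf, RatFunc.algebraMap_X, inv_mul_cancel₀ RatFunc.X_ne_zero, map_one]
  have h2 := dvd_denom h1
  have h3 : X ∣ (δ f).denom := ⟨(δ f).num, by rw [mul_comm, h2, one_mul]⟩
  have h4 := H.two irreducible_X
    (by rw [hDX]; exact fun h => irreducible_X.not_isUnit (isUnit_of_dvd_one h)) f h3
  have h5 := h4.trans (denom_dvd_of X_ne_zero h1)
  have := degree_le_of_dvd h5 X_ne_zero
  rw [degree_X_pow, degree_X] at this
  norm_num at this

end Stmt15Aux



/-- In `ℂ(x)(L)` (modelled as `RatFunc (RatFunc ℂ)` with `x' = 1`, `L' = 1/x`):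
a derivative `z'` of any `z` never has a simple pole at any `β` in the
algebraic closure of `ℂ(x)` (pole order measured in `L` after extending
scalars); consequently any `r` whose derivative is a sum
`c₁·g'/g + Σ c_l·h_l'/h_l` of logarithmic derivatives with constant
coefficients has `r' ∈ ℂ(x)`, with no poles at all in `L`. -/
theorem stmt15 (δK : Derivation ℚ (RatFunc ℂ) (RatFunc ℂ))
    (hK1 : δK RatFunc.X = 1) (hK0 : ∀ z : ℂ, δK (RatFunc.C z) = 0)
    (δ : Derivation ℚ (RatFunc (RatFunc ℂ)) (RatFunc (RatFunc ℂ)))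
    (hδC : ∀ k : RatFunc ℂ, δ (RatFunc.C k) = RatFunc.C (δK k))
    (hδX : δ RatFunc.X = RatFunc.C (RatFunc.X : RatFunc ℂ)⁻¹) :
    (∀ (β : AlgebraicClosure (RatFunc ℂ)) (z : RatFunc (RatFunc ℂ)),
      1 ≤ Polynomial.rootMultiplicity β
          ((δ z).denom.map (algebraMap (RatFunc ℂ) (AlgebraicClosure (RatFunc ℂ)))) →
      2 ≤ Polynomial.rootMultiplicity β
          ((δ z).denom.map (algebraMap (RatFunc ℂ) (AlgebraicClosure (RatFunc ℂ))))) ∧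
    (∀ (n : ℕ) (r g : RatFunc (RatFunc ℂ)) (h c : Fin n → RatFunc (RatFunc ℂ))
        (c₁ : RatFunc (RatFunc ℂ)),
      δ c₁ = 0 → (∀ l, δ (c l) = 0) → g ≠ 0 → (∀ l, h l ≠ 0) →
      δ r = c₁ * (δ g / g) + ∑ l, c l * (δ (h l) / h l) →
      ∃ k : RatFunc ℂ, δ r = RatFunc.C k) := by
  have hder : ∀ (p : Polynomial (RatFunc ℂ)), _ := Stmt15Aux.exists_restrict (fun z => δ z)
    (fun a b => map_add δ a b)
    (fun a b => by simp only [Derivation.leibniz, smul_eq_mul]; ring)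
    (δK : RatFunc ℂ →+ RatFunc ℂ) (RatFunc.X⁻¹) (fun k => hδC k) hδX
  choose D hD hDc using hder
  have H : Stmt15Aux.Restr (fun z => δ z) D :=
    ⟨fun a b => map_add δ a b,
      fun a b => by simp only [Derivation.leibniz, smul_eq_mul]; ring, hD⟩
  have hno := Stmt15Aux.no_antideriv (fun z => δK z) (fun a b => map_add δK a b)
    (fun a b => by simp only [Derivation.leibniz, smul_eq_mul]; ring) hK0 hK1
  have hdeg : ∀ p, (D p).degree ≤ p.degree := by
    intro p
    rw [Polynomial.degree_le_iff_coeff_zero]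
    intro m hm
    rw [hDc, Polynomial.coeff_eq_zero_of_degree_lt hm,
      Polynomial.coeff_eq_zero_of_degree_lt (hm.trans (by exact_mod_cast Nat.lt_succ_self m))]
    simp
  have hDP : ∀ P : Polynomial (RatFunc ℂ), P.Monic → Irreducible P → ¬ P ∣ D P := by
    intro P hm hP hdvd
    have hlt : (D P).degree < P.degree := by
      refine lt_of_le_of_ne (hdeg P) fun he => ?_
      have h1 : (D P).coeff P.natDegree = 0 := by
        rw [hDc, Polynomial.coeff_eq_zero_of_natDegree_lt (Nat.lt_succ_self P.natDegree),
          hm.coeff_natDegree]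
        simp
      rw [← Polynomial.natDegree_eq_of_degree_eq he, Polynomial.coeff_natDegree,
        Polynomial.leadingCoeff_eq_zero] at h1
      rw [h1, Polynomial.degree_zero] at he
      exact hP.ne_zero (Polynomial.degree_eq_bot.1 he.symm)
    have h0 : D P = 0 := Polynomial.eq_zero_of_dvd_of_degree_lt hdvd hlt
    obtain ⟨n, hn⟩ := Nat.exists_eq_succ_of_ne_zero hP.natDegree_pos.ne'
    have h1 := hDc P n
    have h2 : P.coeff (n + 1) = 1 := by
      have := hm.coeff_natDegree
      rwa [hn] at this
    rw [h0, Polynomial.coeff_zero, h2, one_mul] at h1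
    have hc : ((n : RatFunc ℂ) + 1) ≠ 0 := by exact_mod_cast Nat.succ_ne_zero n
    have h3 : δK ((n : RatFunc ℂ) + 1)⁻¹ = 0 := by
      have : ((n : RatFunc ℂ) + 1)⁻¹ = RatFunc.C (((n : ℂ) + 1)⁻¹) := by
        rw [map_inv₀, map_add, map_natCast, map_one]
      rw [this, hK0]
    apply hno (-(P.coeff n * ((n : RatFunc ℂ) + 1)⁻¹))
    have h4 : (0 : RatFunc ℂ) = δK (P.coeff n) + RatFunc.X⁻¹ * ((n : RatFunc ℂ) + 1) := h1
    show δK (-(P.coeff n * ((n : RatFunc ℂ) + 1)⁻¹)) = _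
    rw [map_neg, Derivation.leibniz, h3, smul_zero, zero_add, smul_eq_mul,
      eq_neg_of_add_eq_zero_left h4.symm]
    field_simp
  refine ⟨fun β z h => ?_, fun n r g h c c₁ hc₁ hc hg hh hr => ?_⟩
  · have hne : (δ z).denom.map (algebraMap (RatFunc ℂ) (AlgebraicClosure (RatFunc ℂ))) ≠ 0 :=
      (Polynomial.map_ne_zero_iff (algebraMap (RatFunc ℂ) (AlgebraicClosure (RatFunc ℂ))).injective).2 (δ z).denom_ne_zero
    have hint : IsIntegral (RatFunc ℂ) β := Algebra.IsIntegral.isIntegral β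
    have hroot := (Polynomial.rootMultiplicity_pos hne).1 h
    have hdvd : minpoly (RatFunc ℂ) β ∣ (δ z).denom := by
      apply minpoly.dvd
      rwa [Polynomial.IsRoot, Polynomial.eval_map_algebraMap] at hroot
    have hirr := minpoly.irreducible hint
    have h2 := H.two hirr (hDP _ (minpoly.monic hint) hirr) z hdvd
    rw [Polynomial.le_rootMultiplicity_iff hne]
    have h3 := Polynomial.map_dvd (algebraMap (RatFunc ℂ) (AlgebraicClosure (RatFunc ℂ))) h2
    rw [Polynomial.map_pow] at h3
    refine (pow_dvd_pow_of_dvd ?_ 2).trans h3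
    rw [Polynomial.dvd_iff_isRoot, Polynomial.IsRoot, Polynomial.eval_map_algebraMap]
    exact minpoly.aeval _ _
  · obtain ⟨k₁, rfl⟩ := H.const hDP hc₁
    choose k hk using fun l => H.const hDP (hc l)
    have hS : ∀ P : Polynomial (RatFunc ℂ), Irreducible P → ∀ g, g ≠ 0 →
        Stmt15Aux.SimpleAt P (δ g / g) := by
      intro P hP g hg
      have := H.logDeriv hg
      rw [this]
      exact (H.simple_poly hP (RatFunc.num_ne_zero hg)).add hP
        ((H.simple_poly hP g.denom_ne_zero).smul _)
    have hB : ∀ g, g ≠ 0 → Stmt15Aux.Bdd (δ g / g) := by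
      intro g hg
      have := H.logDeriv hg
      rw [this]
      exact (Stmt15Aux.bdd_poly hdeg (RatFunc.num_ne_zero hg)).add
        ((Stmt15Aux.bdd_poly hdeg g.denom_ne_zero).smul _)
    refine H.final hDP (r := r) (fun P hP => ?_) ?_
    · show Stmt15Aux.SimpleAt P (δ r)
      rw [hr]
      refine ((hS P hP g hg).smul k₁).add hP (Finset.sum_induction _ (Stmt15Aux.SimpleAt P)
        (fun a b ha hb => ha.add hP hb)
        ⟨1, 0, fun h => hP.not_isUnit (isUnit_of_dvd_one h), by simp⟩ fun l _ => ?_)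
      rw [hk l]
      exact (hS P hP _ (hh l)).smul _
    · show Stmt15Aux.Bdd (δ r)
      rw [hr]
      refine ((hB g hg).smul k₁).add (Finset.sum_induction _ Stmt15Aux.Bdd
        (fun a b ha hb => ha.add hb) ⟨1, 0, one_ne_zero, by simp, by simp⟩ fun l _ => ?_)
      rw [hk l]
      exact (hB _ (hh l)).smul _
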